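/- Let a, b, c, μ ∈ ℂ with Re c > 0, Re(a-c-μ+1) > 0 and Re(b-c-μ+1) > 0, and assume that neither c nor a+b-c-μ+1 is a nonpositive integer. Then for every real x > 0, ∫_{-∞}^{0} (-y)^{c-1} F(a,b;c;y) (x-y)^{μ-1} dy = (Γ(a-c-μ+1)Γ(b-c-μ+1)Γ(c)/(Γ(a+b-c-μ+1)Γ(1-μ))) · x^{c+μ-1} · F(a,b; a+b-c-μ+1; 1-x) (a generalized Stieltjes transform of type c+ sending the solution w₁ to the solution w₅ of the hypergeometric differential equation). -/

import Mathlib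

open MeasureTheory Set Complex Filter

/-- Pochhammer symbol `(a)_k = a (a+1) ⋯ (a+k-1)`. -/
noncomputable def poch (a : ℂ) (k : ℕ) : ℂ := ∏ i ∈ Finset.range k, (a + i)

/-- The Gauss hypergeometric function `F(a,b;c;x)` for real `x < 1`, defined by the
power series on `[0,1)` and by the (agreeing) Pfaff series for `x < 0`. -/
noncomputable def hypF (a b c : ℂ) (x : ℝ) : ℂ :=
  if 0 ≤ x then
    ∑' k : ℕ, poch a k * poch b k / (poch c k * (Nat.factorial k : ℂ)) * (x : ℂ) ^ k
  else
    ((1 - x : ℝ) : ℂ) ^ (-a) *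
      ∑' k : ℕ, poch a k * poch (c - b) k / (poch c k * (Nat.factorial k : ℂ)) *
        (((x / (x - 1) : ℝ)) : ℂ) ^ k

open Topology

lemma poch_zero (z : ℂ) : poch z 0 = 1 := by simp [poch]

lemma poch_succ (z : ℂ) (n : ℕ) : poch z (n+1) = poch z n * (z + n) := by
  simp [poch, Finset.prod_range_succ]

lemma poch_succ' (z : ℂ) (n : ℕ) : poch z (n+1) = z * poch (z+1) n := by
  rw [poch, Finset.prod_range_succ', mul_comm, poch]
  have : ∀ i : ℕ, z + ((i+1 : ℕ):ℂ) = z + 1 + i := fun i => by push_cast; ring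
  simp only [this]
  simp

lemma poch_ne_zero {z : ℂ} (h : ∀ n : ℕ, z ≠ -(n:ℂ)) (n : ℕ) : poch z n ≠ 0 := by
  rw [poch, Finset.prod_ne_zero_iff]
  intro i _ h0
  exact h i (eq_neg_of_add_eq_zero_left h0)

lemma poch_add (z : ℂ) (k m : ℕ) : poch z (k+m) = poch z k * poch (z+k) m := by
  induction m with
  | zero => simp [poch_zero]
  | succ m ih => rw [← add_assoc, poch_succ, ih, poch_succ]; push_cast; ring

lemma poch_neg_eq_zero {m n : ℕ} (h : m < n) : poch (-(m:ℂ)) n = 0 := by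
  rw [poch, Finset.prod_eq_zero_iff]
  exact ⟨m, by simpa using h, by simp⟩

lemma poch_one (n : ℕ) : poch 1 n = (n.factorial : ℂ) := by
  induction n with
  | zero => simp [poch_zero]
  | succ n ih => rw [poch_succ, ih, Nat.factorial_succ]; push_cast; ring

lemma poch_norm_le (z : ℂ) (n : ℕ) : ‖poch z n‖ ≤ ‖poch (‖z‖:ℂ) n‖ := by
  rw [poch, poch, norm_prod, norm_prod]
  apply Finset.prod_le_prod
  · intros; positivity
  · intro i _
    have : ‖((‖z‖:ℂ) + (i:ℂ))‖ = ‖z‖ + i := by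
      rw [show ((‖z‖:ℂ) + (i:ℂ)) = ((‖z‖ + i : ℝ):ℂ) by push_cast; rfl, Complex.norm_real,
        Real.norm_of_nonneg (by positivity)]
    rw [this]
    exact (norm_add_le _ _).trans (by simp)

lemma poch_real_norm (r : ℝ) (hr : 0 ≤ r) (n : ℕ) : ((‖poch (r:ℂ) n‖ : ℝ) : ℂ) = poch (r:ℂ) n := by
  rw [poch, norm_prod, Complex.ofReal_prod]
  refine Finset.prod_congr rfl fun i _ => ?_
  rw [show ((r:ℂ) + (i:ℂ)) = ((r + i : ℝ):ℂ) by push_cast; rfl, Complex.norm_real,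
        Real.norm_of_nonneg (by positivity)]

lemma Gamma_inv_poch (z : ℂ) (k : ℕ) : (Complex.Gamma z)⁻¹ = poch z k * (Complex.Gamma (z+k))⁻¹ := by
  induction k with
  | zero => simp [poch_zero]
  | succ k ih =>
    rw [ih, Complex.one_div_Gamma_eq_self_mul_one_div_Gamma_add_one (z+k), poch_succ]
    push_cast; ring_nf

lemma Gamma_add_poch {z : ℂ} (h : ∀ n : ℕ, z ≠ -(n:ℂ)) (k : ℕ) :
    Complex.Gamma (z+k) = poch z k * Complex.Gamma z := by
  have h1 := Gamma_inv_poch z k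
  have h2 := Complex.Gamma_ne_zero h
  have h3 : Complex.Gamma (z+k) ≠ 0 := by
    intro h0
    rw [h0] at h1
    simp at h1
    exact h2 h1
  field_simp at h1
  rw [h1]; ring

lemma ne_neg_of_re_pos {z : ℂ} (h : 0 < z.re) (n : ℕ) : z ≠ -(n:ℂ) := by
  intro h0
  rw [h0] at h
  simp at h
  have : (0:ℝ) ≤ n := by positivity
  linarith

lemma poch_tendsto (z : ℂ) :
    Tendsto (fun n : ℕ => poch z (n+1) / ((n:ℂ)^z * n.factorial)) atTop (𝓝 (Complex.Gamma z)⁻¹) := by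
  by_cases h : ∃ m : ℕ, z = -(m:ℂ)
  · have h' := (Complex.Gamma_eq_zero_iff z).2 h
    obtain ⟨m, rfl⟩ := h
    rw [h', inv_zero]
    apply tendsto_const_nhds.congr'
    filter_upwards [eventually_ge_atTop m] with n hn
    rw [poch_neg_eq_zero (by omega), zero_div]
  · push Not at h
    have := (Complex.GammaSeq_tendsto_Gamma z).inv₀ (Complex.Gamma_ne_zero h)
    refine this.congr fun n => ?_
    rw [Complex.GammaSeq, poch, inv_div]

lemma norm_tendsto_bdd {f : ℕ → ℂ} {l : ℂ} (h : Tendsto f atTop (𝓝 l)) : ∃ C, 0 < C ∧ ∀ n, ‖f n‖ ≤ C := by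
  obtain ⟨C, hC⟩ := h.norm.bddAbove_range
  refine ⟨max C 1, by positivity, fun n => (hC ⟨n, rfl⟩).trans (le_max_left _ _)⟩

lemma poch_bound (z : ℂ) : ∃ C : ℝ, 0 < C ∧ ∀ n : ℕ, 1 ≤ n →
    ‖poch z (n+1)‖ ≤ C * ((n:ℝ)^z.re * n.factorial) := by
  obtain ⟨C, hC, h⟩ := norm_tendsto_bdd (poch_tendsto z)
  refine ⟨C, hC, fun n hn => ?_⟩
  have := h n
  rw [norm_div, norm_mul, Complex.norm_natCast_cpow_of_pos (by omega), Complex.norm_natCast,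
    div_le_iff₀ (by positivity)] at this
  exact this

lemma poch_inv_bound (z : ℂ) : ∃ C : ℝ, 0 < C ∧ ∀ n : ℕ, 1 ≤ n →
    ‖poch z (n+1)‖⁻¹ ≤ C / ((n:ℝ)^z.re * n.factorial) := by
  obtain ⟨C, hC, h⟩ := norm_tendsto_bdd (Complex.GammaSeq_tendsto_Gamma z)
  refine ⟨C, hC, fun n hn => ?_⟩
  have := h n
  rw [Complex.GammaSeq, norm_div, norm_mul, Complex.norm_natCast_cpow_of_pos (by omega), Complex.norm_natCast] at this
  rw [le_div_iff₀ (by positivity), mul_comm, ← div_eq_mul_inv]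
  exact this

noncomputable def hT (α β γ : ℂ) (k : ℕ) : ℂ := poch α k * poch β k / (poch γ k * (Nat.factorial k : ℂ))

noncomputable def hS (α β γ : ℂ) (z : ℂ) : ℂ := ∑' k : ℕ, hT α β γ k * z ^ k

lemma hT_comm (α β γ : ℂ) (k : ℕ) : hT α β γ k = hT β α γ k := by
  simp only [hT, mul_comm]

lemma hS_comm (α β γ z : ℂ) : hS α β γ z = hS β α γ z := by
  simp only [hS, hT_comm α β]

lemma hT_bound (α β γ : ℂ) : ∃ C : ℝ, 0 < C ∧ ∀ n : ℕ, 1 ≤ n →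
    ‖hT α β γ (n+1)‖ ≤ C * (n:ℝ)^((α+β-γ).re-1) := by
  obtain ⟨C1, h1, H1⟩ := poch_bound α
  obtain ⟨C2, h2, H2⟩ := poch_bound β
  obtain ⟨C3, h3, H3⟩ := poch_inv_bound γ
  refine ⟨C1*C2*C3, by positivity, fun n hn => ?_⟩
  have hn0 : (0:ℝ) < n := by exact_mod_cast hn
  have hf : (0:ℝ) < n.factorial := by positivity
  have e1 : ‖hT α β γ (n+1)‖ = ‖poch α (n+1)‖ * ‖poch β (n+1)‖ * ‖poch γ (n+1)‖⁻¹ * ((n+1) * n.factorial : ℝ)⁻¹ := by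
    rw [hT, norm_div, norm_mul, norm_mul, Complex.norm_natCast, Nat.factorial_succ]
    push_cast
    rw [div_eq_mul_inv, mul_inv]
    ring
  have e2 : ((n+1) * n.factorial : ℝ)⁻¹ ≤ (n * n.factorial : ℝ)⁻¹ := by
    gcongr
    linarith
  have e3 : (n:ℝ)^((α+β-γ).re-1) = n^α.re * n^β.re / n^γ.re / n := by
    rw [Real.rpow_sub hn0, Complex.sub_re, Complex.add_re, Real.rpow_sub hn0, Real.rpow_add hn0, Real.rpow_one]
  rw [e1, e3]
  calc _ ≤ (C1 * ((n:ℝ)^α.re * n.factorial)) * (C2 * ((n:ℝ)^β.re * n.factorial)) * (C3 / ((n:ℝ)^γ.re * n.factorial)) * (n * n.factorial : ℝ)⁻¹ := by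
        gcongr
        · exact H1 n hn
        · exact H2 n hn
        · exact H3 n hn
    _ = _ := by
        have : (0:ℝ) < (n:ℝ)^γ.re := by positivity
        field_simp

lemma summable_of_bound {f : ℕ → ℝ} (h0 : ∀ n, 0 ≤ f n) {C p : ℝ} (hp : p < -1)
    (h : ∀ n : ℕ, 1 ≤ n → f (n+1) ≤ C * (n:ℝ)^p) : Summable f := by
  rw [← summable_nat_add_iff 2]
  have : Summable (fun n : ℕ => C * ((n+1:ℕ):ℝ)^p) :=
    ((summable_nat_add_iff 1).2 (Real.summable_nat_rpow.2 hp)).mul_left C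
  exact Summable.of_nonneg_of_le (fun n => h0 _) (fun n => h (n+1) (by omega)) this

lemma hT_summable {α β γ : ℂ} (h : 0 < (γ-α-β).re) :
    Summable (fun n => ‖hT α β γ n‖) := by
  obtain ⟨C, hC, H⟩ := hT_bound α β γ
  refine summable_of_bound (fun _ => norm_nonneg _) (p := (α+β-γ).re-1) ?_ H
  simp at h ⊢
  linarith

lemma summable_geom_of_bound {f : ℕ → ℂ} {C p : ℝ}
    (h : ∀ n : ℕ, 1 ≤ n → ‖f (n+1)‖ ≤ C * (n:ℝ)^p) {r : ℝ} (hr0 : 0 ≤ r) (hr : r < 1) : 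
    Summable (fun n => ‖f n‖ * r^n) := by
  rw [← summable_nat_add_iff 2]
  obtain ⟨N, hN⟩ := exists_nat_ge p
  have h1 : Summable (fun n : ℕ => ((n:ℝ)^N * r^n : ℝ)) :=
    summable_pow_mul_geometric_of_norm_lt_one N (by rwa [Real.norm_of_nonneg hr0])
  have : Summable (fun n : ℕ => (C * r) * (((n+1:ℕ):ℝ)^N * r^(n+1))) :=
    ((summable_nat_add_iff 1).2 h1).mul_left (C*r)
  have hC : 0 ≤ C := by simpa using (norm_nonneg _).trans (h 1 le_rfl)
  refine Summable.of_nonneg_of_le (fun n => by positivity) (fun n => ?_) this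
  have h2 := h (n+1) (by omega)
  have h3 : (((n+1:ℕ):ℝ)^p) ≤ ((n+1:ℕ):ℝ)^N := by
    rw [← Real.rpow_natCast]
    apply Real.rpow_le_rpow_of_exponent_le _ hN
    simp
  calc _ ≤ (C * ((n+1:ℕ):ℝ)^N) * r^(n+2) := by
        gcongr
        exact h2.trans (by gcongr)
    _ = _ := by ring

lemma hT_summable_geom (α β γ : ℂ) {r : ℝ} (hr0 : 0 ≤ r) (hr : r < 1) :
    Summable (fun n => ‖hT α β γ n‖ * r^n) := by
  obtain ⟨C, hC, H⟩ := hT_bound α β γ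
  exact summable_geom_of_bound H hr0 hr

lemma one_ne_neg (n : ℕ) : (1:ℂ) ≠ -(n:ℂ) := ne_neg_of_re_pos (by simp) n

lemma hT_one_eq (s : ℂ) (k : ℕ) : hT s 1 1 k = poch s k / (k.factorial : ℂ) := by
  have : (k.factorial : ℂ) ≠ 0 := by exact_mod_cast k.factorial_ne_zero
  rw [hT, poch_one]
  field_simp

lemma choose_eq_poch (s : ℂ) (k : ℕ) : Ring.choose (-s) k = (-1)^k * (poch s k / (k.factorial : ℂ)) := by
  have h := Ring.descPochhammer_eq_factorial_smul_choose (-s) k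
  have hk : (k.factorial : ℂ) ≠ 0 := by exact_mod_cast k.factorial_ne_zero
  have h2 : (descPochhammer ℤ k).smeval (-s) = (-1)^k * poch s k := by
    clear h hk
    induction k with
    | zero => simp [poch_zero]
    | succ k ih =>
      rw [poch_succ, descPochhammer_succ_right, Polynomial.smeval_mul, ih]
      simp [Polynomial.smeval_natCast]
      ring
  rw [h2, nsmul_eq_mul] at h
  field_simp
  rw [h]; ring

lemma binom_hasSum (s : ℂ) {z : ℂ} (hz : ‖z‖ < 1) :
    HasSum (fun k : ℕ => poch s k / (k.factorial : ℂ) * z^k) ((1 - z)^(-s)) := by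
  have h := (Complex.one_add_cpow_hasFPowerSeriesOnBall_zero (a := -s)).hasSum (y := -z)
    (by simpa [Metric.mem_eball, edist_zero_right, enorm_eq_nnnorm, ← NNReal.coe_lt_coe] using hz)
  have e : (1 + (0 + -z)) = 1 - z := by ring
  rw [e] at h
  convert! h using 1
  ext k
  rw [binomialSeries_apply, choose_eq_poch]
  have : (-z)^k = (-1)^k * z^k := by rw [← mul_pow]; simp
  have h1 : ((-1:ℂ)^k) * (-1)^k = 1 := by rw [← mul_pow]; simp
  simp [this]
  linear_combination (-(poch s k / (k.factorial:ℂ) * z^k)) * h1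

lemma hT_shift (α β : ℂ) {γ : ℂ} (hγ : ∀ n : ℕ, γ ≠ -(n:ℂ)) (n : ℕ) :
    γ * (γ-α-β) * hT α β γ n - (γ-α)*(γ-β) * hT α β (γ+1) n
      = γ * (n * hT α β γ n) - γ * ((n+1:ℕ) * hT α β γ (n+1)) := by
  have h1 : poch γ n ≠ 0 := poch_ne_zero hγ n
  have h2 : γ + n ≠ 0 := fun h => hγ n (eq_neg_of_add_eq_zero_left h)
  have h0 : γ ≠ 0 := by simpa using hγ 0
  have h3 : poch (γ+1) n = poch γ n * (γ+n) / γ := by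
    rw [← poch_succ, poch_succ']; field_simp
  have hk : (n.factorial : ℂ) ≠ 0 := by exact_mod_cast n.factorial_ne_zero
  have hn : (n:ℂ) + 1 ≠ 0 := by exact_mod_cast n.succ_ne_zero
  rw [hT, hT, hT, h3, poch_succ, poch_succ, poch_succ, Nat.factorial_succ]
  push_cast
  field_simp
  ring

lemma hT_mul_tendsto {α β γ : ℂ} (h : 0 < (γ-α-β).re) :
    Tendsto (fun n : ℕ => γ * ((n:ℂ) * hT α β γ n)) atTop (𝓝 0) := by
  rw [← mul_zero γ]
  refine Tendsto.const_mul γ ?_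
  rw [← tendsto_add_atTop_iff_nat 1]
  obtain ⟨C, hC, H⟩ := hT_bound α β γ
  have h1 : Tendsto (fun n : ℕ => 2 * C * (n:ℝ)^(-(γ-α-β).re)) atTop (𝓝 0) := by
    rw [← mul_zero (2*C)]
    exact ((tendsto_rpow_neg_atTop h).comp tendsto_natCast_atTop_atTop).const_mul _
  refine squeeze_zero_norm' ?_ h1
  filter_upwards [eventually_ge_atTop 1] with n hn
  have hn1 : (1:ℝ) ≤ n := by exact_mod_cast hn
  have hn0 : (0:ℝ) < n := by linarith
  rw [norm_mul, Complex.norm_natCast]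
  have e : (n:ℝ)^(-(γ-α-β).re) = n * (n:ℝ)^((α+β-γ).re-1) := by
    rw [Real.rpow_sub_one hn0.ne']
    field_simp
    congr 1
    simp; ring
  rw [e]
  calc _ ≤ (2 * n : ℝ) * (C * (n:ℝ)^((α+β-γ).re-1)) := by
        gcongr
        · push_cast; linarith
        · exact H n hn
    _ = _ := by ring

lemma gauss_step {α β γ : ℂ} (hγ : ∀ n : ℕ, γ ≠ -(n:ℂ)) (h : 0 < (γ-α-β).re) :
    γ * (γ-α-β) * (∑' n, hT α β γ n) = (γ-α)*(γ-β) * ∑' n, hT α β (γ+1) n := by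
  have s1 : Summable (fun n => hT α β γ n) := (hT_summable h).of_norm
  have s2 : Summable (fun n => hT α β (γ+1) n) := by
    apply Summable.of_norm
    apply hT_summable
    simp at h ⊢; linarith
  have H := ((s1.hasSum.mul_left (γ * (γ-α-β))).sub (s2.hasSum.mul_left ((γ-α)*(γ-β)))).tendsto_sum_nat
  simp only [hT_shift α β hγ] at H
  have e : ∀ n : ℕ, ∑ i ∈ Finset.range n, (γ * (i * hT α β γ i) - γ * ((i+1:ℕ) * hT α β γ (i+1)))
     = 0 - γ * (n * hT α β γ n) := by
    intro n
    rw [Finset.sum_range_sub' (fun i : ℕ => γ * (i * hT α β γ i))]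
    simp
  simp only [e] at H
  have H2 := (tendsto_const_nhds (x := (0:ℂ))).sub (hT_mul_tendsto h)
  have := tendsto_nhds_unique H H2
  rw [sub_zero] at this
  exact sub_eq_zero.1 this

lemma add_nat_ne_neg {γ : ℂ} (hγ : ∀ n : ℕ, γ ≠ -(n:ℂ)) (m n : ℕ) : γ + m ≠ -(n:ℂ) := by
  intro h
  apply hγ (n+m)
  push_cast
  linear_combination h

lemma gauss_iter {α β γ : ℂ} (hγ : ∀ n : ℕ, γ ≠ -(n:ℂ)) (h : 0 < (γ-α-β).re) (n : ℕ) :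
    poch γ n * poch (γ-α-β) n * (∑' k, hT α β γ k) = poch (γ-α) n * poch (γ-β) n * ∑' k, hT α β (γ+n) k := by
  induction n with
  | zero => simp [poch_zero]
  | succ n ih =>
    have := gauss_step (α := α) (β := β) (add_nat_ne_neg hγ n) (by
      simp at h ⊢
      have : (0:ℝ) ≤ n := by positivity
      linarith)
    simp only [poch_succ]
    push_cast
    rw [← add_assoc]
    linear_combination (γ + n) * (γ-α-β+n) * ih + poch (γ-α) n * poch (γ-β) n * this

lemma poch_norm_ge {ρ : ℝ} {z : ℂ} (h0 : 0 ≤ ρ) (h : ρ ≤ z.re) (n : ℕ) : ‖poch (ρ:ℂ) n‖ ≤ ‖poch z n‖ := by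
  rw [poch, poch, norm_prod, norm_prod]
  apply Finset.prod_le_prod
  · intros; positivity
  · intro i _
    have : ‖((ρ:ℂ) + (i:ℂ))‖ = ρ + i := by
      rw [show ((ρ:ℂ) + (i:ℂ)) = ((ρ + i : ℝ):ℂ) by push_cast; rfl, Complex.norm_real,
        Real.norm_of_nonneg (by positivity)]
    rw [this]
    have h2 := (Complex.re_le_norm (z + i))
    simp at h2
    linarith

lemma inv_add_tendsto (w : ℂ) : Tendsto (fun n : ℕ => (w + (n:ℂ))⁻¹) atTop (𝓝 0) := by
  apply tendsto_inv₀_cobounded.comp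
  rw [← tendsto_norm_atTop_iff_cobounded]
  refine tendsto_atTop_mono (f := fun n : ℕ => (n:ℝ) + w.re) (fun n => ?_) ?_
  · have := Complex.re_le_norm (w + n)
    simp at this
    linarith
  · exact tendsto_atTop_add_const_right _ _ tendsto_natCast_atTop_atTop

lemma poch_inv_tendsto (γ : ℂ) (k : ℕ) :
    Tendsto (fun n : ℕ => (poch (γ+n) k)⁻¹) atTop (𝓝 (if k = 0 then 1 else 0)) := by
  induction k with
  | zero => simp [poch_zero]
  | succ k ih =>
    have := ih.mul (inv_add_tendsto (γ+k))
    rw [mul_zero] at this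
    simp only [Nat.add_eq_zero_iff, one_ne_zero, and_false, if_false]
    refine this.congr fun n => ?_
    rw [poch_succ, mul_inv]
    congr 2; ring

lemma gauss_limit (α β γ : ℂ) :
    Tendsto (fun n : ℕ => ∑' k, hT α β (γ+n) k) atTop (𝓝 1) := by
  have e : (1:ℂ) = ∑' k : ℕ, (if k = 0 then 1 else 0) := by simp
  rw [e]
  set ρ : ℝ := ‖α‖ + ‖β‖ + 1 with hρ
  have hρ0 : 0 < ρ := by positivity
  have hs : Summable (fun n => ‖hT (‖α‖:ℂ) (‖β‖:ℂ) (ρ:ℂ) n‖) := by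
    apply hT_summable
    rw [hρ]; simp; linarith
  refine tendsto_tsum_of_dominated_convergence hs ?_ ?_
  · intro k
    have := (poch_inv_tendsto γ k).const_mul (poch α k * poch β k / (k.factorial : ℂ))
    have e2 : (poch α k * poch β k / (k.factorial : ℂ)) * (if k = 0 then 1 else 0) = if k = 0 then 1 else 0 := by
      split_ifs with h
      · simp [h, poch_zero]
      · simp
    rw [e2] at this
    refine this.congr fun n => ?_
    rw [hT]; ring
  · obtain ⟨N, hN⟩ := exists_nat_ge (ρ - γ.re)
    filter_upwards [eventually_ge_atTop N] with n hn k
    have hnN : (N:ℝ) ≤ n := by exact_mod_cast hn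
    have h1 : ‖poch (ρ:ℂ) k‖ ≤ ‖poch (γ+n) k‖ := poch_norm_ge hρ0.le (by simp; linarith) k
    have h2 : 0 < ‖poch (ρ:ℂ) k‖ := by
      rw [norm_pos_iff]
      exact poch_ne_zero (ne_neg_of_re_pos (by simpa using hρ0)) k
    have hk : 0 < ‖(k.factorial : ℂ)‖ := by
      rw [norm_pos_iff]; exact_mod_cast k.factorial_ne_zero
    rw [hT, hT, norm_div, norm_div, norm_mul, norm_mul, norm_mul, norm_mul]
    gcongr
    · exact poch_norm_le α k
    · exact poch_norm_le β k

theorem gauss {α β γ : ℂ} (hγ : ∀ n : ℕ, γ ≠ -(n:ℂ)) (h : 0 < (γ-α-β).re) :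
    HasSum (fun n => hT α β γ n) (Complex.Gamma γ * Complex.Gamma (γ-α-β) * (Complex.Gamma (γ-α))⁻¹ * (Complex.Gamma (γ-β))⁻¹) := by
  have s1 : Summable (fun n => hT α β γ n) := (hT_summable h).of_norm
  have H := (((((Complex.GammaSeq_tendsto_Gamma γ).mul (Complex.GammaSeq_tendsto_Gamma (γ-α-β))).mul
    (poch_tendsto (γ-α))).mul (poch_tendsto (γ-β))).mul 
      ((gauss_limit α β γ).comp (tendsto_add_atTop_nat 1)))
  rw [mul_one] at H
  suffices (∑' k, hT α β γ k) = Complex.Gamma γ * Complex.Gamma (γ-α-β) * (Complex.Gamma (γ-α))⁻¹ * (Complex.Gamma (γ-β))⁻¹ by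
    rw [← this]; exact s1.hasSum
  refine tendsto_nhds_unique (tendsto_const_nhds.congr' ?_) H
  filter_upwards [eventually_ge_atTop 1] with n hn
  have hG := gauss_iter hγ h (n+1)
  have hn0 : (n:ℂ) ≠ 0 := by exact_mod_cast (by omega : n ≠ 0)
  have p1 := poch_ne_zero hγ (n+1)
  have p2 := poch_ne_zero (ne_neg_of_re_pos h) (n+1)
  have hk : (n.factorial : ℂ) ≠ 0 := by exact_mod_cast n.factorial_ne_zero
  have q1 : (n:ℂ)^(γ-α) ≠ 0 := by simp [Complex.cpow_eq_zero_iff, hn0]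
  have q2 : (n:ℂ)^(γ-β) ≠ 0 := by simp [Complex.cpow_eq_zero_iff, hn0]
  have e : (n:ℂ)^γ * (n:ℂ)^(γ-α-β) = (n:ℂ)^(γ-α) * (n:ℂ)^(γ-β) := by
    rw [← Complex.cpow_add _ _ hn0, ← Complex.cpow_add _ _ hn0]; congr 1; ring
  simp only [Function.comp, Complex.GammaSeq]
  change _ = _ / poch γ (n+1) * (_ / poch (γ-α-β) (n+1)) * _ * _ * _
  rw [← mul_div_mul_comm]
  rw [show (n:ℂ)^γ * (n.factorial:ℂ) * ((n:ℂ)^(γ-α-β) * (n.factorial:ℂ)) = (n:ℂ)^(γ-α) * (n:ℂ)^(γ-β) * (n.factorial:ℂ)^2 by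
    rw [← e]; ring]
  field_simp
  rw [← hG]; ring

lemma diff_tsum {f : ℕ → ℂ} (h : ∀ r : ℝ, 0 ≤ r → r < 1 → Summable (fun n => ‖f n‖ * r^n)) :
    DifferentiableOn ℂ (fun z => ∑' n, f n * z^n) (Metric.ball 0 1) := by
  intro z hz
  have hz' : ‖z‖ < 1 := by simpa using hz
  obtain ⟨r, h1, h2⟩ := exists_between hz'
  have hr : 0 ≤ r := (norm_nonneg z).trans h1.le
  have := Complex.differentiableOn_tsum_of_summable_norm (U := Metric.ball (0:ℂ) r) 
    (F := fun n z => f n * z^n) (h r hr h2) (fun i => by fun_prop) Metric.isOpen_ball ?_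
  · exact (this.differentiableAt (Metric.isOpen_ball.mem_nhds (by simpa using h1))).differentiableWithinAt
  · intro i w hw
    have hw' : ‖w‖ < r := by simpa using hw
    rw [norm_mul, norm_pow]
    gcongr

lemma hS_diff (α β γ : ℂ) : DifferentiableOn ℂ (hS α β γ) (Metric.ball 0 1) :=
  diff_tsum (fun _ h0 h1 => hT_summable_geom α β γ h0 h1)

lemma one_sub_cpow_diff (s : ℂ) : DifferentiableOn ℂ (fun z : ℂ => (1 - z)^s) (Metric.ball 0 1) := by
  intro z hz
  apply DifferentiableAt.differentiableWithinAt
  apply DifferentiableAt.cpow_const (by fun_prop)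
  have hz' : ‖z‖ < 1 := by simpa using hz
  left
  have := Complex.re_le_norm z
  simp; linarith

lemma ball_identity {f g : ℂ → ℂ} (hf : DifferentiableOn ℂ f (Metric.ball 0 1))
    (hg : DifferentiableOn ℂ g (Metric.ball 0 1)) {ε : ℝ} (hε : 0 < ε)
    (h : ∀ t : ℝ, 0 < t → t < ε → f t = g t) : EqOn f g (Metric.ball 0 1) := by
  refine (hf.analyticOnNhd Metric.isOpen_ball).eqOn_of_preconnected_of_frequently_eq
    (hg.analyticOnNhd Metric.isOpen_ball) (convex_ball _ _).isPreconnected (z₀ := 0) (by simp) ?_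
  have h1 : Tendsto (fun t : ℝ => (t:ℂ)) (𝓝[>] 0) (𝓝[≠] (0:ℂ)) := by
    apply tendsto_nhdsWithin_of_tendsto_nhds_of_eventually_within
    · have : Tendsto (fun t : ℝ => (t:ℂ)) (𝓝 0) (𝓝 ((0:ℝ):ℂ)) := Complex.continuous_ofReal.tendsto 0
      exact this.mono_left nhdsWithin_le_nhds
    · filter_upwards [self_mem_nhdsWithin] with t ht
      simpa using (ne_of_gt ht)
  apply h1.frequently
  apply Eventually.frequently
  filter_upwards [Ioo_mem_nhdsGT hε] with t ht
  exact h t ht.1 ht.2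

lemma vandermonde (a : ℂ) {d : ℂ} (hd : ∀ n : ℕ, d ≠ -(n:ℂ)) (n : ℕ) :
    ∑ p ∈ Finset.HasAntidiagonal.antidiagonal n, (n.choose p.1 : ℂ) * ((-1)^p.1 * poch a p.1 / poch d p.1)
      = poch (d-a) n / poch d n := by
  induction n generalizing a d with
  | zero => simp [poch_zero]
  | succ n ih =>
    rw [Finset.sum_antidiagonal_choose_succ_mul (fun i _ => (-1)^i * poch a i / poch d i)]
    have hd0 : d ≠ 0 := by simpa using hd 0
    have hd1 : ∀ n : ℕ, d + 1 ≠ -(n:ℂ) := by simpa using add_nat_ne_neg hd 1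
    have e : ∑ p ∈ Finset.HasAntidiagonal.antidiagonal n, (n.choose p.2 : ℂ) * ((-1)^(p.1+1) * poch a (p.1+1) / poch d (p.1+1))
       = (-(a/d)) * ∑ p ∈ Finset.HasAntidiagonal.antidiagonal n, (n.choose p.1 : ℂ) * ((-1)^p.1 * poch (a+1) p.1 / poch (d+1) p.1) := by
      rw [Finset.mul_sum]
      refine Finset.sum_congr rfl fun p hp => ?_
      rw [Finset.HasAntidiagonal.mem_antidiagonal] at hp
      rw [Nat.choose_symm_of_eq_add (by omega : n = p.2 + p.1), poch_succ', poch_succ']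
      have := poch_ne_zero hd1 p.1
      field_simp
      ring
    rw [e, ih a hd, ih (a+1) hd1]
    have h1 := poch_ne_zero hd n
    have h2 : d + n ≠ 0 := fun h => hd n (eq_neg_of_add_eq_zero_left h)
    have h3 : poch (d+1) n = poch d n * (d+n) / d := by
      rw [← poch_succ, poch_succ']; field_simp
    rw [h3, poch_succ, poch_succ, show d + 1 - (a+1) = d - a by ring]
    field_simp
    ring

lemma antidiag_tsum {g : ℕ × ℕ → ℂ} (hg : Summable g) :
    ∑' k, ∑' m, g (k, m) = ∑' n, ∑ p ∈ Finset.HasAntidiagonal.antidiagonal n, g p := by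
  rw [← hg.tsum_prod]
  rw [← (Finset.HasAntidiagonal.sigmaAntidiagonalEquivProd (A := ℕ)).tsum_eq g]
  rw [Summable.tsum_sigma']
  · refine tsum_congr fun n => ?_
    rw [tsum_fintype]
    simp only [Finset.HasAntidiagonal.sigmaAntidiagonalEquivProd_apply]
    exact Finset.sum_coe_sort (Finset.HasAntidiagonal.antidiagonal n) g
  · intro n; exact (hasSum_fintype _).summable
  · exact (Finset.HasAntidiagonal.sigmaAntidiagonalEquivProd (A := ℕ)).summable_iff.2 hg

lemma pfaff (α β : ℂ) {γ z : ℂ} (hγ : ∀ n : ℕ, γ ≠ -(n:ℂ)) (hz : ‖z‖ < 1/2) :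
    hS α β γ z = (1 - z)^(-α) * hS α (γ-β) γ (z/(z-1)) := by
  set r := ‖z‖ with hr
  have hr0 : 0 ≤ r := norm_nonneg z
  have hz1 : ‖z‖ < 1 := by linarith
  have h1z : 1 - z ≠ 0 := by
    intro h
    have : z = 1 := by linear_combination -h
    rw [this] at hz1; simp at hz1
  have hr1 : (0:ℝ) < 1 - r := by linarith
  obtain ⟨g, hgdef⟩ : ∃ g : ℕ × ℕ → ℂ, ∀ k m : ℕ, g (k,m) =
      hT α (γ-β) γ k * (-z)^k * (poch (α+k) m / (m.factorial:ℂ) * z^m) :=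
    ⟨fun p => hT α (γ-β) γ p.1 * (-z)^p.1 * (poch (α+p.1) p.2 / (p.2.factorial:ℂ) * z^p.2), fun _ _ => rfl⟩
  have hrow : ∀ k : ℕ, HasSum (fun m => g (k,m)) (hT α (γ-β) γ k * (-z)^k * (1-z)^(-(α+k))) := by
    intro k
    simp only [hgdef]
    exact (binom_hasSum (α+k) hz1).mul_left _
  have hbr : ∀ k : ℕ, HasSum (fun m : ℕ => ‖poch ((‖α‖+k:ℝ):ℂ) m‖ / (m.factorial:ℝ) * r^m) ((1-r)^(-(‖α‖+k))) := by
    intro k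
    have := binom_hasSum ((‖α‖+k:ℝ):ℂ) (z := (r:ℂ)) (by simpa [abs_of_nonneg hr0] using hz1)
    rw [← Complex.hasSum_ofReal]
    convert! this using 1
    · ext m
      rw [Complex.ofReal_mul, Complex.ofReal_div, poch_real_norm _ (by positivity)]
      push_cast
      rfl
    · rw [Complex.ofReal_cpow hr1.le]; push_cast; rfl
  have hle : ∀ k m : ℕ, ‖g (k,m)‖ ≤ ‖hT α (γ-β) γ k‖ * r^k * (‖poch ((‖α‖+k:ℝ):ℂ) m‖ / (m.factorial:ℝ) * r^m) := by
    intro k m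
    simp only [hgdef, norm_mul, norm_pow, norm_neg, norm_div, Complex.norm_natCast]
    have : ‖poch (α+k) m‖ ≤ ‖poch ((‖α‖+k:ℝ):ℂ) m‖ := by
      refine (poch_norm_le _ _).trans (poch_norm_ge (norm_nonneg _) ?_ m)
      rw [Complex.ofReal_re]
      exact (norm_add_le _ _).trans (by simp)
    gcongr
  have hsum : Summable g := by
    apply Summable.of_norm
    rw [summable_prod_of_nonneg (fun _ => norm_nonneg _)]
    constructor
    · intro k
      exact Summable.of_nonneg_of_le (fun _ => norm_nonneg _) (hle k) ((hbr k).summable.mul_left _)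
    · have hq : r / (1-r) < 1 := by rw [div_lt_one hr1]; linarith
      have hs := (hT_summable_geom α (γ-β) γ (by positivity) hq).mul_left ((1-r)^(-‖α‖))
      refine Summable.of_nonneg_of_le (fun _ => tsum_nonneg fun _ => norm_nonneg _) (fun k => ?_) hs
      have hb := (hbr k).mul_left (‖hT α (γ-β) γ k‖ * r^k)
      refine (Summable.tsum_le_tsum (hle k) (Summable.of_nonneg_of_le (fun _ => norm_nonneg _) (hle k) hb.summable) hb.summable).trans ?_
      rw [hb.tsum_eq, neg_add, Real.rpow_add hr1, Real.rpow_neg hr1.le (k:ℝ), Real.rpow_natCast, div_pow]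
      apply le_of_eq
      field_simp
  have key := antidiag_tsum hsum
  have eL : ∑' k, ∑' m, g (k, m) = (1 - z)^(-α) * hS α (γ-β) γ (z/(z-1)) := by
    rw [hS, ← tsum_mul_left]
    refine tsum_congr fun k => ?_
    rw [(hrow k).tsum_eq, neg_add, Complex.cpow_add _ _ h1z, Complex.cpow_neg _ (k:ℂ), Complex.cpow_natCast,
      show z/(z-1) = (-z)/(1-z) by rw [← neg_sub 1 z, div_neg, neg_div], div_pow]
    field_simp
  rw [← eL, key, hS]
  refine tsum_congr fun n => ?_
  have hv := vandermonde (γ-β) hγ n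
  rw [sub_sub_cancel] at hv
  have hn : (n.factorial : ℂ) ≠ 0 := by exact_mod_cast n.factorial_ne_zero
  have : hT α β γ n * z^n = (poch α n * z^n / (n.factorial:ℂ)) * (poch β n / poch γ n) := by
    rw [hT]; field_simp
  rw [this, ← hv, Finset.mul_sum]
  refine Finset.sum_congr rfl fun p hp => ?_
  rw [Finset.HasAntidiagonal.mem_antidiagonal] at hp
  obtain ⟨k, m⟩ := p
  simp only at hp
  subst hp
  have hk : (k.factorial : ℂ) ≠ 0 := by exact_mod_cast k.factorial_ne_zero
  have hm : (m.factorial : ℂ) ≠ 0 := by exact_mod_cast m.factorial_ne_zero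
  have hc : ((k+m).choose k : ℂ) = ((k+m).factorial : ℂ) / (k.factorial * m.factorial) := by
    rw [eq_div_iff (by positivity)]
    have := Nat.add_choose_mul_factorial_mul_factorial k m
    rw [Nat.choose_symm_add, ← mul_assoc]; exact_mod_cast this
  have hp := poch_ne_zero hγ k
  simp only [hgdef, hT]
  rw [hc, poch_add, neg_pow z, pow_add]
  field_simp

lemma euler (α β : ℂ) {γ z : ℂ} (hγ : ∀ n : ℕ, γ ≠ -(n:ℂ)) (hz : ‖z‖ < 1) :
    hS α β γ z = (1 - z)^(γ-α-β) * hS (γ-α) (γ-β) γ z := by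
  refine ball_identity (hS_diff α β γ) ((one_sub_cpow_diff _).mul (hS_diff _ _ _)) (ε := 1/4) (by norm_num) ?_ (by simpa using hz)
  intro t ht0 ht1
  have h1t : (0:ℝ) < 1 - t := by linarith
  have e1 := pfaff α β hγ (z := (t:ℂ)) (by simp [abs_of_pos ht0]; linarith)
  have e2 := pfaff (γ-β) α hγ (z := (t:ℂ)/(t-1)) (by
    have : (t:ℂ)/(t-1) = ((t/(t-1):ℝ):ℂ) := by push_cast; rfl
    rw [this, Complex.norm_real, Real.norm_eq_abs, abs_div, abs_of_pos ht0, abs_of_neg (by linarith), div_lt_iff₀ (by linarith)]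
    linarith)
  have h1 : (t:ℂ) - 1 ≠ 0 := by
    intro h
    have : ((t - 1 : ℝ):ℂ) = 0 := by push_cast; exact h
    rw [Complex.ofReal_eq_zero] at this; linarith
  have h2 : (1:ℂ) - t ≠ 0 := fun h => h1 (by linear_combination -h)
  have e3 : (t:ℂ)/(t-1)/((t:ℂ)/(t-1)-1) = t := by
    have : (t:ℂ)/(t-1)-1 = 1/(t-1) := by field_simp; ring
    rw [this]; field_simp
  have e4 : 1 - (t:ℂ)/(t-1) = (((1-t)⁻¹ : ℝ):ℂ) := by
    push_cast
    field_simp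
    ring
  rw [e3, e4] at e2
  rw [e1, hS_comm, e2, hS_comm (γ-β)]
  simp only [Pi.mul_apply]
  rw [← mul_assoc]
  congr 1
  rw [show (1:ℂ) - t = ((1-t:ℝ):ℂ) by push_cast; rfl, Complex.ofReal_inv, Complex.inv_cpow, ← Complex.cpow_neg,
    ← Complex.cpow_add]
  · congr 1; ring
  · exact_mod_cast h1t.ne'
  · rw [Complex.arg_ofReal_of_nonneg h1t.le]; exact Real.pi_pos.ne

lemma integrable_tsum_aux {m : Measure ℝ} {F : ℕ → ℝ → ℂ} (hF : ∀ i, Integrable (F i) m)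
    (hs : Summable fun i => ∫ t, ‖F i t‖ ∂m)
    (hm : AEStronglyMeasurable (fun t => ∑' i, F i t) m) :
    Integrable (fun t => ∑' i, F i t) m := by
  refine ⟨hm, ?_⟩
  refine lt_of_le_of_lt (lintegral_mono fun t => enorm_tsum_le_tsum_enorm) ?_
  rw [lintegral_tsum fun i => (hF i).1.enorm]
  simp_rw [← fun i => ofReal_integral_norm_eq_lintegral_enorm (hF i)]
  rw [← ENNReal.ofReal_tsum_of_nonneg (fun i => integral_nonneg fun t => norm_nonneg _) hs]
  exact ENNReal.ofReal_lt_top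

lemma beta_int {p q : ℂ} (hp : 0 < p.re) (hq : 0 < q.re) :
    IntegrableOn (fun t : ℝ => (t:ℂ)^(p-1) * (1 - (t:ℂ))^(q-1)) (Ioo 0 1) ∧
    ∫ t in Ioo (0:ℝ) 1, (t:ℂ)^(p-1) * (1 - (t:ℂ))^(q-1) =
      Complex.Gamma p * Complex.Gamma q / Complex.Gamma (p+q) := by
  constructor
  · have := Complex.betaIntegral_convergent hp hq
    rw [intervalIntegrable_iff_integrableOn_Ioo_of_le zero_le_one] at this
    exact this
  · rw [← Complex.betaIntegral_eq_Gamma_mul_div p q hp hq, Complex.betaIntegral,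
      intervalIntegral.integral_of_le zero_le_one, integral_Ioc_eq_integral_Ioo]

lemma norm_cpow_pair (p q : ℂ) {t : ℝ} (ht : t ∈ Ioo (0:ℝ) 1) :
    ((‖(t:ℂ)^(p-1) * (1 - (t:ℂ))^(q-1)‖ : ℝ) : ℂ) =
      (t:ℂ)^(((p.re:ℝ):ℂ)-1) * (1 - (t:ℂ))^(((q.re:ℝ):ℂ)-1) := by
  have h1 : (1 - (t:ℂ)) = ((1 - t : ℝ) : ℂ) := by push_cast; rfl
  have h2 : 0 < 1 - t := by linarith [ht.2]
  rw [h1, norm_mul, Complex.norm_cpow_eq_rpow_re_of_pos ht.1,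
    Complex.norm_cpow_eq_rpow_re_of_pos h2]
  push_cast
  rw [Complex.ofReal_cpow ht.1.le, Complex.ofReal_cpow h2.le]
  simp

lemma beta_int_norm {p q : ℂ} (hp : 0 < p.re) (hq : 0 < q.re) :
    ((∫ t in Ioo (0:ℝ) 1, ‖(t:ℂ)^(p-1) * (1 - (t:ℂ))^(q-1)‖ : ℝ) : ℂ) =
      Complex.Gamma (p.re:ℂ) * Complex.Gamma (q.re:ℂ) / Complex.Gamma ((p.re:ℂ)+(q.re:ℂ)) := by
  rw [← (beta_int (p := (p.re:ℂ)) (q := (q.re:ℂ)) (by simpa using hp) (by simpa using hq)).2,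
    ← integral_complex_ofReal]
  exact setIntegral_congr_fun measurableSet_Ioo fun t ht => norm_cpow_pair p q ht

lemma moment {a β c A : ℂ} (hc : 0 < c.re) (hA : 0 < A.re) (h : 0 < (c + A - a - β).re) :
    IntegrableOn (fun u : ℝ => (u:ℂ)^(c-1) * (1 - (u:ℂ))^(A-1) * hS a β c u) (Ioo 0 1) ∧
    ∫ u in Ioo (0:ℝ) 1, (u:ℂ)^(c-1) * (1 - (u:ℂ))^(A-1) * hS a β c u =
      Complex.Gamma c * Complex.Gamma A * Complex.Gamma (c+A-a-β) *
        (Complex.Gamma (c+A-a))⁻¹ * (Complex.Gamma (c+A-β))⁻¹ := by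
  set F : ℕ → ℝ → ℂ := fun n u => hT a β c n * ((u:ℂ)^(c+n-1) * (1 - (u:ℂ))^(A-1)) with hF
  have hcn : ∀ n : ℕ, 0 < (c + n).re := fun n => by
    simp; positivity
  have hI : ∀ n, Integrable (F n) (volume.restrict (Ioo 0 1)) := fun n =>
    (beta_int (hcn n) hA).1.const_mul _
  have hγ : ∀ n : ℕ, c + A ≠ -(n:ℂ) := ne_neg_of_re_pos (by simp; linarith)
  have hpt : ∀ u ∈ Ioo (0:ℝ) 1, (u:ℂ)^(c-1) * (1 - (u:ℂ))^(A-1) * hS a β c u = ∑' n, F n u := by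
    intro u hu
    rw [hS, ← tsum_mul_left]
    congr 1; ext n
    have hu0 : (u:ℂ) ≠ 0 := by exact_mod_cast hu.1.ne'
    have : (u:ℂ)^(c+n-1) = (u:ℂ)^(c-1) * (u:ℂ)^n := by
      rw [← Complex.cpow_natCast, ← Complex.cpow_add _ _ hu0]; congr 1; ring
    simp only [hF, this]; ring
  -- the norm integrals
  have hN : ∀ n, ∫ u in Ioo (0:ℝ) 1, ‖F n u‖ =
      ‖hT a β c n‖ * (‖Complex.Gamma (c.re:ℂ) * Complex.Gamma (A.re:ℂ) /
        Complex.Gamma ((c.re:ℂ) + (A.re:ℂ))‖ * (‖poch (c.re:ℂ) n‖ *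
          ‖poch ((c.re:ℂ)+(A.re:ℂ)) n‖⁻¹)) := by
    intro n
    simp only [hF, norm_mul (hT a β c n)]
    rw [integral_const_mul]
    congr 1
    have h0 := beta_int_norm (hcn n) hA
    have h1 : (0:ℝ) ≤ ∫ u in Ioo (0:ℝ) 1, ‖(u:ℂ)^(c+n-1) * (1 - (u:ℂ))^(A-1)‖ :=
      integral_nonneg fun _ => norm_nonneg _
    have h2 := congrArg norm h0
    rw [Complex.norm_real, Real.norm_of_nonneg h1] at h2
    rw [h2]
    have e1 : (((c + n).re : ℝ) : ℂ) = (c.re:ℂ) + n := by simp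
    have e2 : (c.re:ℂ) + n + (A.re:ℂ) = (c.re:ℂ) + (A.re:ℂ) + n := by ring
    rw [e1, e2, Gamma_add_poch (ne_neg_of_re_pos (by simpa using hc)) n,
      Gamma_add_poch (z := (c.re:ℂ) + (A.re:ℂ)) (ne_neg_of_re_pos (by simp; linarith)) n]
    simp only [norm_mul, norm_div]
    ring
  have hsum : Summable fun n => ∫ u in Ioo (0:ℝ) 1, ‖F n u‖ := by
    simp_rw [hN]
    obtain ⟨C1, hC1, h1⟩ := hT_bound a β c
    obtain ⟨C2, hC2, h2⟩ := poch_bound (c.re:ℂ)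
    obtain ⟨C3, hC3, h3⟩ := poch_inv_bound ((c.re:ℂ)+(A.re:ℂ))
    set G := ‖Complex.Gamma (c.re:ℂ) * Complex.Gamma (A.re:ℂ) /
        Complex.Gamma ((c.re:ℂ) + (A.re:ℂ))‖
    have hG : 0 ≤ G := norm_nonneg _
    refine summable_of_bound (C := C1 * (G * (C2 * C3))) (p := -(c+A-a-β).re - 1)
      (fun n => by positivity) (by linarith) ?_
    intro n hn
    have hn' : (0:ℝ) < n := by exact_mod_cast hn
    have hfac : (0:ℝ) < n.factorial := by exact_mod_cast n.factorial_pos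
    calc _ ≤ C1*(n:ℝ)^((a+β-c).re-1) * (G * ((C2*((n:ℝ)^(c.re:ℂ).re * n.factorial)) *
          (C3/((n:ℝ)^((c.re:ℂ)+(A.re:ℂ)).re * n.factorial)))) := by
          gcongr
          · exact h1 n hn
          · exact h2 n hn
          · exact h3 n hn
      _ = C1 * (G * (C2 * C3)) * (n:ℝ)^(-(c+A-a-β).re - 1) := by
          have : (n:ℝ)^(-(c+A-a-β).re - 1) = (n:ℝ)^((a+β-c).re-1) * ((n:ℝ)^(c.re:ℂ).re) /
              (n:ℝ)^((c.re:ℂ)+(A.re:ℂ)).re := by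
            rw [← Real.rpow_add hn', ← Real.rpow_sub hn']
            congr 1
            simp
            ring
          rw [this]
          have hp : (n:ℝ)^((c.re:ℂ)+(A.re:ℂ)).re ≠ 0 := (Real.rpow_pos_of_pos hn' _).ne'
          field_simp
  have hmeas : AEStronglyMeasurable (fun u => ∑' n, F n u) (volume.restrict (Ioo (0:ℝ) 1)) := by
    have hcont : ContinuousOn (fun u : ℝ => (u:ℂ)^(c-1) * (1 - (u:ℂ))^(A-1) * hS a β c u)
        (Ioo (0:ℝ) 1) := by
      refine ContinuousOn.mul (ContinuousOn.mul ?_ ?_) ?_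
      · intro u hu
        refine ContinuousAt.continuousWithinAt ?_
        refine ContinuousAt.cpow (Complex.continuous_ofReal.continuousAt) continuousAt_const
          (Or.inl ?_)
        simpa using hu.1
      · intro u hu
        refine ContinuousAt.continuousWithinAt ?_
        refine ContinuousAt.cpow ?_ continuousAt_const (Or.inl ?_)
        · fun_prop
        · simpa using hu.2
      · refine (hS_diff a β c).continuousOn.comp Complex.continuous_ofReal.continuousOn ?_
        intro u hu
        simp [abs_lt]
        constructor <;> linarith [hu.1, hu.2]
    refine (hcont.aestronglyMeasurable measurableSet_Ioo).congr ?_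
    filter_upwards [ae_restrict_mem measurableSet_Ioo] with u hu using hpt u hu
  have hIntegrable := integrable_tsum_aux hI hsum hmeas
  constructor
  · refine hIntegrable.congr ?_
    filter_upwards [ae_restrict_mem measurableSet_Ioo] with u hu using (hpt u hu).symm
  · rw [setIntegral_congr_fun measurableSet_Ioo hpt]
    have h1 := hasSum_integral_of_summable_integral_norm hI hsum
    have h2 := (gauss (α := a) (β := β) hγ h).mul_left
      (Complex.Gamma c * Complex.Gamma A / Complex.Gamma (c+A))
    have hG : Complex.Gamma (c+A) ≠ 0 := Complex.Gamma_ne_zero hγ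
    have h3 : (fun n => ∫ u in Ioo (0:ℝ) 1, F n u) =
        fun n => Complex.Gamma c * Complex.Gamma A / Complex.Gamma (c+A) * hT a β (c+A) n := by
      ext n
      simp only [hF]
      rw [integral_const_mul, (beta_int (hcn n) hA).2]
      have e2 : c + n + A = c + A + n := by ring
      rw [e2, Gamma_add_poch (ne_neg_of_re_pos hc) n, Gamma_add_poch hγ n, hT, hT]
      have := poch_ne_zero (ne_neg_of_re_pos hc) n
      have := poch_ne_zero hγ n
      have : (n.factorial:ℂ) ≠ 0 := by exact_mod_cast n.factorial_ne_zero
      field_simp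
    rw [h3] at h1
    rw [h1.unique h2]
    field_simp

lemma mul_pow_int {h : ℝ → ℂ} {v : ℝ → ℝ} (hh : IntegrableOn h (Ioo 0 1)) (hv : Continuous v)
    (hv1 : ∀ u ∈ Ioo (0:ℝ) 1, |v u| ≤ 1) (k : ℕ) :
    IntegrableOn (fun u => h u * (v u : ℂ)^k) (Ioo 0 1) ∧
    ∫ u in Ioo (0:ℝ) 1, ‖h u * (v u : ℂ)^k‖ ≤ ∫ u in Ioo (0:ℝ) 1, ‖h u‖ := by
  have hb : ∀ u ∈ Ioo (0:ℝ) 1, ‖h u * (v u : ℂ)^k‖ ≤ ‖h u‖ := by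
    intro u hu
    rw [norm_mul, norm_pow, Complex.norm_real, Real.norm_eq_abs]
    exact mul_le_of_le_one_right (norm_nonneg _) (pow_le_one₀ (abs_nonneg _) (hv1 u hu))
  have hi : IntegrableOn (fun u => h u * (v u : ℂ)^k) (Ioo 0 1) := by
    refine Integrable.mono hh ?_ ?_
    · refine hh.1.mul (Continuous.aestronglyMeasurable ?_)
      fun_prop
    · filter_upwards [ae_restrict_mem measurableSet_Ioo] with u hu using hb u hu
  exact ⟨hi, setIntegral_mono_on hi.norm hh.norm measurableSet_Ioo hb⟩

lemma binom_int {h : ℝ → ℂ} {v : ℝ → ℝ} (hh : IntegrableOn h (Ioo 0 1)) (hv : Continuous v)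
    (hv1 : ∀ u ∈ Ioo (0:ℝ) 1, |v u| ≤ 1) (s : ℂ) {z : ℂ} (hz : ‖z‖ < 1) :
    HasSum (fun k : ℕ => poch s k / (k.factorial : ℂ) *
        (∫ u in Ioo (0:ℝ) 1, h u * (v u : ℂ)^k) * z^k)
      (∫ u in Ioo (0:ℝ) 1, h u * (1 - z * (v u : ℂ))^(-s)) := by
  set F : ℕ → ℝ → ℂ := fun k u => (poch s k / (k.factorial : ℂ) * z^k) * (h u * (v u : ℂ)^k) with hF
  have hI : ∀ k, Integrable (F k) (volume.restrict (Ioo 0 1)) := fun k =>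
    (mul_pow_int hh hv hv1 k).1.const_mul _
  have hsum : Summable fun k => ∫ u in Ioo (0:ℝ) 1, ‖F k u‖ := by
    refine Summable.of_nonneg_of_le (fun k => integral_nonneg fun _ => norm_nonneg _) (fun k => ?_)
      ((hT_summable_geom s 1 1 (norm_nonneg z) hz).mul_right (∫ u in Ioo (0:ℝ) 1, ‖h u‖))
    simp only [hF, norm_mul (poch s k / (k.factorial : ℂ) * z^k)]
    rw [integral_const_mul, hT_one_eq, norm_mul (poch s k / (k.factorial : ℂ)), norm_pow]
    exact mul_le_mul_of_nonneg_left (mul_pow_int hh hv hv1 k).2 (by positivity)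
  have h1 := hasSum_integral_of_summable_integral_norm hI hsum
  have g1 : (fun k : ℕ => poch s k / (k.factorial : ℂ) *
        (∫ u in Ioo (0:ℝ) 1, h u * (v u : ℂ)^k) * z^k) =
      fun k => ∫ u in Ioo (0:ℝ) 1, F k u := by
    ext k
    simp only [hF]
    rw [integral_const_mul]; ring
  have g2 : (∫ u in Ioo (0:ℝ) 1, h u * (1 - z * (v u : ℂ))^(-s)) =
      ∫ u in Ioo (0:ℝ) 1, ∑' k, F k u := by
    refine setIntegral_congr_fun measurableSet_Ioo fun u hu => ?_
    have hn : ‖z * (v u : ℂ)‖ < 1 := by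
      rw [norm_mul, Complex.norm_real, Real.norm_eq_abs]
      exact lt_of_le_of_lt (mul_le_of_le_one_right (norm_nonneg _) (hv1 u hu)) hz
    have := ((binom_hasSum s hn).mul_left (h u)).tsum_eq
    change _ = ∑' k, poch s k / (k.factorial : ℂ) * z^k * (h u * (v u : ℂ)^k)
    rw [← this]
    congr 1; ext k
    rw [mul_pow]; ring
  rw [g1, g2]
  exact h1

lemma ofReal_div_cpow {p q : ℝ} (hp : 0 < p) (hq : 0 < q) (z : ℂ) :
    ((p / q : ℝ) : ℂ)^z = (p:ℂ)^z * (q:ℂ)^(-z) := by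
  rw [div_eq_mul_inv, Complex.ofReal_mul, Complex.mul_cpow_ofReal_nonneg hp.le (inv_pos.2 hq).le,
    Complex.ofReal_inv, Complex.cpow_neg, Complex.inv_cpow]
  rw [Complex.arg_ofReal_of_nonneg hq.le]
  exact Real.pi_pos.ne

lemma hypF_neg (a b c : ℂ) {y : ℝ} (hy : y < 0) :
    hypF a b c y = ((1 - y : ℝ) : ℂ)^(-a) * hS a (c - b) c ((y / (y - 1) : ℝ) : ℂ) := by
  rw [hypF, if_neg (not_le.2 hy)]; rfl

lemma hypF_nonneg (a b c : ℂ) {y : ℝ} (hy : 0 ≤ y) :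
    hypF a b c y = hS a b c (y : ℂ) := by
  rw [hypF, if_pos hy]; rfl

lemma change_var (a b c μ : ℂ) {x : ℝ} (hx : 0 < x) :
    ∫ y in Iio (0:ℝ),
        ((-y : ℝ) : ℂ) ^ (c - 1) * hypF a b c y * ((x - y : ℝ) : ℂ) ^ (μ - 1) =
    ∫ u in Ioo (0:ℝ) 1, ((u:ℂ)^(c-1) * (1 - (u:ℂ))^((a - c - μ + 1)-1) * hS a (c-b) c u) *
      ((x * (1 - u) + u : ℝ) : ℂ)^(μ - 1) := by
  have himg : (fun u : ℝ => u / (u - 1)) '' (Ioo 0 1) = Iio 0 := by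
    ext y
    simp only [mem_image, mem_Ioo, mem_Iio]
    constructor
    · rintro ⟨u, ⟨h0, h1⟩, rfl⟩
      exact div_neg_of_pos_of_neg h0 (by linarith)
    · intro hy
      have h1 : y - 1 < 0 := by linarith
      refine ⟨y / (y - 1), ⟨div_pos_of_neg_of_neg hy h1, ?_⟩, ?_⟩
      · rw [div_lt_one_of_neg h1]; linarith
      · have : y - 1 ≠ 0 := h1.ne
        have h2 : y / (y-1) - 1 = 1 / (y - 1) := by field_simp; ring
        rw [h2]; field_simp
  have hinj : InjOn (fun u : ℝ => u / (u - 1)) (Ioo 0 1) := by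
    intro u hu v hv huv
    have h1 : u - 1 ≠ 0 := by linarith [hu.2]
    have h2 : v - 1 ≠ 0 := by linarith [hv.2]
    change u / (u - 1) = v / (v - 1) at huv
    rw [div_eq_div_iff h1 h2] at huv
    linarith
  have hder : ∀ u ∈ Ioo (0:ℝ) 1, HasDerivWithinAt (fun u : ℝ => u / (u - 1))
      (-(1 / (1 - u)^2)) (Ioo 0 1) u := by
    intro u hu
    have h1 : u - 1 ≠ 0 := by linarith [hu.2]
    have h2 : 1 - u ≠ 0 := by linarith [hu.2]
    have h3 := (((hasDerivAt_id' u).fun_div ((hasDerivAt_id' u).sub_const 1) h1).hasDerivWithinAt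
      (s := Ioo 0 1))
    refine h3.congr_deriv ?_
    have h4 : (u-1)^2 = (1-u)^2 := by ring
    rw [h4]; field_simp
    ring
  rw [← himg, integral_image_eq_integral_abs_deriv_smul measurableSet_Ioo hder hinj]
  refine setIntegral_congr_fun measurableSet_Ioo fun u hu => ?_
  have hu0 := hu.1
  have hu1 : 0 < 1 - u := by linarith [hu.2]
  have hu1' : u - 1 ≠ 0 := by linarith
  have hu1'' : 1 - u ≠ 0 := hu1.ne'
  have hy : u / (u - 1) < 0 := div_neg_of_pos_of_neg hu0 (by linarith)
  have e1 : -(u / (u-1)) = u / (1 - u) := by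
    rw [← div_neg]; congr 1; ring
  have e2 : 1 - u / (u - 1) = 1 / (1 - u) := by
    rw [sub_eq_add_neg, e1]; field_simp; ring
  have e3 : x - u / (u - 1) = (x * (1 - u) + u) / (1 - u) := by
    rw [sub_eq_add_neg, e1]; field_simp
  have e4 : u / (u - 1) / (u / (u - 1) - 1) = u := by
    have : u / (u-1) - 1 = 1 / (u - 1) := by field_simp; ring
    rw [this]; field_simp
  have hpos : 0 < x * (1 - u) + u := by positivity
  rw [hypF_neg a b c hy, e1, e2, e3, e4, ofReal_div_cpow hu0 hu1, ofReal_div_cpow one_pos hu1,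
    ofReal_div_cpow hpos hu1, abs_neg, abs_of_pos (by positivity), Complex.real_smul]
  have hne : ((1 - u : ℝ) : ℂ) ≠ 0 := by exact_mod_cast hu1''
  have e5 : (1 - (u:ℂ)) = ((1 - u : ℝ) : ℂ) := by push_cast; rfl
  have e6 : (((1 / (1 - u)^2 : ℝ)) : ℂ) = ((1 - u : ℝ) : ℂ)^(-2 : ℂ) := by
    rw [Complex.cpow_neg, Complex.cpow_ofNat]; push_cast; rw [one_div]
  have e7 : ((1 - u : ℝ) : ℂ)^((a - c - μ + 1) - 1) = ((1 - u : ℝ) : ℂ)^(-2 : ℂ) *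
      ((1 - u : ℝ) : ℂ)^(-(c-1)) * ((1 - u : ℝ) : ℂ)^(- -a) * ((1 - u : ℝ) : ℂ)^(-(μ-1)) := by
    rw [← Complex.cpow_add _ _ hne, ← Complex.cpow_add _ _ hne, ← Complex.cpow_add _ _ hne]
    congr 1; ring
  rw [e5, e6, e7, Complex.ofReal_one, Complex.one_cpow]
  ring

lemma small_case {a b c μ : ℂ} (hc : 0 < c.re)
    (ha : 0 < (a - c - μ + 1).re) (hb : 0 < (b - c - μ + 1).re)
    (hd : ∀ n : ℕ, a + b - c - μ + 1 ≠ -(n : ℂ)) {x : ℝ} (hx : |1 - x| < 1) :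
    ∫ u in Ioo (0:ℝ) 1, ((u:ℂ)^(c-1) * (1 - (u:ℂ))^((a - c - μ + 1)-1) * hS a (c-b) c u) *
      ((x * (1 - u) + u : ℝ) : ℂ)^(μ - 1) =
    Complex.Gamma (a - c - μ + 1) * Complex.Gamma (b - c - μ + 1) * Complex.Gamma c /
          (Complex.Gamma (a + b - c - μ + 1) * Complex.Gamma (1 - μ)) *
      hS (a - c - μ + 1) (b - c - μ + 1) (a + b - c - μ + 1) ((1 - x : ℝ) : ℂ) := by
  have e0 : c + (a - c - μ + 1) - a - (c - b) = b - c - μ + 1 := by ring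
  have hh := (moment (a := a) (β := c - b) hc ha (by rw [e0]; exact hb)).1
  have hz : ‖((1 - x : ℝ) : ℂ)‖ < 1 := by
    rw [Complex.norm_real]; exact hx
  have H := binom_int (v := fun u => 1 - u) hh (by fun_prop)
    (fun u hu => by rw [abs_le]; constructor <;> linarith [hu.1, hu.2]) (1 - μ) hz
  have e1 : ∀ u : ℝ, (1 - ((1 - x : ℝ) : ℂ) * ((1 - u : ℝ) : ℂ))^(-(1-μ)) =
      ((x * (1 - u) + u : ℝ) : ℂ)^(μ - 1) := by
    intro u
    congr 1
    · push_cast; ring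
    · ring
  simp only [e1] at H
  rw [← H.tsum_eq, hS, ← tsum_mul_left]
  congr 1; ext k
  have hak : 0 < (a - c - μ + 1 + k).re := by
    have : (0:ℝ) ≤ k := k.cast_nonneg
    simp at ha ⊢; linarith
  have hbk : 0 < (b - c - μ + 1 + k).re := by
    have : (0:ℝ) ≤ k := k.cast_nonneg
    simp at hb ⊢; linarith
  have e2 : c + (a - c - μ + 1 + k) - a - (c - b) = b - c - μ + 1 + k := by ring
  have e3 : c + (a - c - μ + 1 + k) - a = 1 - μ + k := by ring
  have e4 : c + (a - c - μ + 1 + k) - (c - b) = a + b - c - μ + 1 + k := by ring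
  have M := (moment (a := a) (β := c - b) hc hak (by rw [e2]; exact hbk)).2
  rw [e2, e3, e4] at M
  have e5 : (∫ u in Ioo (0:ℝ) 1, ((u:ℂ)^(c-1) * (1 - (u:ℂ))^((a - c - μ + 1)-1) *
      hS a (c-b) c u) * ((1 - u : ℝ) : ℂ)^k) =
      ∫ u in Ioo (0:ℝ) 1, (u:ℂ)^(c-1) * (1 - (u:ℂ))^((a - c - μ + 1 + k)-1) *
      hS a (c-b) c u := by
    refine setIntegral_congr_fun measurableSet_Ioo fun u hu => ?_
    have hne : (1 - (u:ℂ)) ≠ 0 := by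
      have : (1 - u : ℝ) ≠ 0 := by linarith [hu.2]
      exact_mod_cast this
    have : (1 - (u:ℂ))^((a - c - μ + 1 + k)-1) =
        (1 - (u:ℂ))^((a - c - μ + 1)-1) * (1 - (u:ℂ))^k := by
      rw [← Complex.cpow_natCast, ← Complex.cpow_add _ _ hne]; congr 1; ring
    simp only [this]
    push_cast
    ring
  rw [e5, M, Gamma_add_poch (ne_neg_of_re_pos ha) k, Gamma_add_poch (ne_neg_of_re_pos hb) k, hT,
    div_eq_mul_inv _ (Complex.Gamma (a + b - c - μ + 1) * Complex.Gamma (1 - μ)), mul_inv,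
    Gamma_inv_poch (1 - μ) k, Gamma_inv_poch (a + b - c - μ + 1) k]
  have := poch_ne_zero hd k
  have : (k.factorial:ℂ) ≠ 0 := by exact_mod_cast k.factorial_ne_zero
  field_simp

lemma large_case {a b c μ : ℂ} (hc : 0 < c.re)
    (ha : 0 < (a - c - μ + 1).re) (hb : 0 < (b - c - μ + 1).re)
    (hd : ∀ n : ℕ, a + b - c - μ + 1 ≠ -(n : ℂ)) {x : ℝ} (hx : 1 < x) :
    ∫ u in Ioo (0:ℝ) 1, ((u:ℂ)^(c-1) * (1 - (u:ℂ))^((a - c - μ + 1)-1) * hS a (c-b) c u) *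
      ((x * (1 - u) + u : ℝ) : ℂ)^(μ - 1) =
    Complex.Gamma (a - c - μ + 1) * Complex.Gamma (b - c - μ + 1) * Complex.Gamma c /
          (Complex.Gamma (a + b - c - μ + 1) * Complex.Gamma (1 - μ)) *
      ((x:ℂ)^(c + μ - 1 - a) *
      hS (a - c - μ + 1) a (a + b - c - μ + 1) ((1 - 1 / x : ℝ) : ℂ)) := by
  have e0 : c + (a - c - μ + 1) - a - (c - b) = b - c - μ + 1 := by ring
  have hh := (moment (a := a) (β := c - b) hc ha (by rw [e0]; exact hb)).1
  have hv1 : ∀ u ∈ Ioo (0:ℝ) 1, |u| ≤ 1 := fun u hu => by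
    rw [abs_le]; constructor <;> linarith [hu.1, hu.2]
  set h : ℝ → ℂ := fun u => (u:ℂ)^(c-1) * (1 - (u:ℂ))^((a - c - μ + 1)-1) * hS a (c-b) c u with hdef
  set K : ℂ := Complex.Gamma (a - c - μ + 1) * Complex.Gamma (b - c - μ + 1) * Complex.Gamma c /
          (Complex.Gamma (a + b - c - μ + 1) * Complex.Gamma (1 - μ)) with hK
  set m : ℕ → ℂ := fun k => poch (1-μ) k / (k.factorial : ℂ) *
        (∫ u in Ioo (0:ℝ) 1, h u * (u : ℂ)^k) with hm
  have hM : DifferentiableOn ℂ (fun z => ∑' n, m n * z^n) (Metric.ball 0 1) := by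
    refine diff_tsum fun r hr0 hr1 => ?_
    refine Summable.of_nonneg_of_le (fun k => by positivity) (fun k => ?_)
      ((hT_summable_geom (1-μ) 1 1 hr0 hr1).mul_right (∫ u in Ioo (0:ℝ) 1, ‖h u‖))
    rw [hT_one_eq, hm]
    simp only
    rw [norm_mul]
    have := (norm_integral_le_integral_norm _).trans
      (mul_pow_int (v := fun u => u) hh continuous_id hv1 k).2
    calc _ ≤ ‖poch (1-μ) k / (k.factorial : ℂ)‖ * (∫ u in Ioo (0:ℝ) 1, ‖h u‖) * r^k := by
          gcongr
      _ = _ := by ring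
  -- the integral in terms of the power series in w
  have key : ∀ y : ℝ, 1 < y → (∫ u in Ioo (0:ℝ) 1, h u * ((y * (1 - u) + u : ℝ) : ℂ)^(μ - 1)) =
      (y:ℂ)^(μ-1) * ∑' n, m n * (((1 - 1/y : ℝ)) : ℂ)^n := by
    intro y hy
    have hy0 : 0 < y := by linarith
    have hw0 : 0 ≤ 1 - 1 / y := by
      rw [sub_nonneg, div_le_one hy0]; exact hy.le
    have hw1 : 1 - 1 / y < 1 := by
      have : 0 < 1 / y := by positivity
      linarith
    have hz : ‖(((1 - 1/y : ℝ)) : ℂ)‖ < 1 := by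
      rw [Complex.norm_real, Real.norm_of_nonneg hw0]; exact hw1
    have H := binom_int (v := fun u => u) hh continuous_id hv1 (1-μ) hz
    rw [H.tsum_eq, ← integral_const_mul]
    refine setIntegral_congr_fun measurableSet_Ioo fun u hu => ?_
    have hp : 0 ≤ 1 - (1 - 1/y) * u := by nlinarith [hu.1, hu.2]
    have g1 : y * (1 - u) + u = y * (1 - (1 - 1/y) * u) := by field_simp; ring
    have g2 : -(1 - μ) = μ - 1 := by ring
    have g3 : (1 - (((1 - 1/y : ℝ)) : ℂ) * (u:ℂ)) = ((1 - (1 - 1/y) * u : ℝ) : ℂ) := by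
      push_cast; rfl
    rw [g1, g2, g3, Complex.ofReal_mul, Complex.mul_cpow_ofReal_nonneg hy0.le hp]
    ring
  have hG : DifferentiableOn ℂ (fun z : ℂ => K * ((1 - z)^(a - c) *
      hS (a - c - μ + 1) a (a + b - c - μ + 1) z)) (Metric.ball 0 1) :=
    ((one_sub_cpow_diff (a - c)).mul (hS_diff _ _ _)).const_mul K
  have hE := ball_identity hM hG (ε := 1/4) (by norm_num) ?_
  · have hx0 : 0 < x := by linarith
    have hw0 : 0 ≤ 1 - 1 / x := by
      rw [sub_nonneg, div_le_one hx0]; exact hx.le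
    have hw1 : 1 - 1 / x < 1 := by
      have : 0 < 1 / x := by positivity
      linarith
    have hz : (((1 - 1/x : ℝ)) : ℂ) ∈ Metric.ball (0:ℂ) 1 := by
      rw [mem_ball_zero_iff, Complex.norm_real, Real.norm_of_nonneg hw0]; exact hw1
    have := hE hz
    simp only at this
    rw [key x hx, this]
    have g1 : 1 - (((1 - 1/x : ℝ)) : ℂ) = ((1 / x : ℝ) : ℂ) := by push_cast; ring
    have hxne : (x:ℂ) ≠ 0 := by exact_mod_cast hx0.ne'
    have g2 : (x:ℂ)^(c + μ - 1 - a) = (x:ℂ)^(μ - 1) * (x:ℂ)^(-(a - c)) := by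
      rw [← Complex.cpow_add _ _ hxne]; congr 1; ring
    rw [g1, ofReal_div_cpow one_pos hx0, g2, Complex.ofReal_one, Complex.one_cpow]
    ring
  · intro t ht0 ht1
    have h1t : 0 < 1 - t := by linarith
    set y : ℝ := 1 / (1 - t) with hy
    have hy1 : 1 < y := by rw [hy, lt_div_iff₀ h1t]; linarith
    have hy2 : y < 4/3 := by rw [hy, div_lt_iff₀ h1t]; linarith
    have hy0 : 0 < y := by linarith
    have hyt : 1 - 1 / y = t := by rw [hy]; field_simp; ring
    have hyne : (y:ℂ) ≠ 0 := by exact_mod_cast hy0.ne'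
    have k1 := key y hy1
    rw [hyt, small_case hc ha hb hd (by rw [abs_lt]; constructor <;> linarith),
      hS_comm] at k1
    have hz : ‖((1 - y : ℝ) : ℂ)‖ < 1/2 := by
      rw [Complex.norm_real, Real.norm_eq_abs, abs_lt]; constructor <;> linarith
    rw [hS_comm, pfaff _ _ hd hz] at k1
    have g1 : a + b - c - μ + 1 - (b - c - μ + 1) = a := by ring
    have g2 : ((1 - y : ℝ) : ℂ) / (((1 - y : ℝ) : ℂ) - 1) = (t:ℂ) := by
      have q : ((1 - y : ℝ) : ℂ) - 1 = -(y:ℂ) := by push_cast; ring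
      rw [q, ← hyt]; push_cast; field_simp; ring
    have g3 : 1 - ((1 - y : ℝ) : ℂ) = (y:ℂ) := by push_cast; ring
    have g4 : (1 - (t:ℂ)) = ((1 / y : ℝ) : ℂ) := by rw [← hyt]; push_cast; ring
    rw [g1, g2, g3] at k1
    have g5 : (y:ℂ)^(μ - 1) ≠ 0 := by
      rw [Complex.cpow_ne_zero_iff]; left; exact hyne
    have g6 : (y:ℂ)^(-(a - c - μ + 1)) = (y:ℂ)^(μ - 1) * (y:ℂ)^(-(a - c)) := by
      rw [← Complex.cpow_add _ _ hyne]; congr 1; ring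
    rw [g6] at k1
    rw [g4, ofReal_div_cpow one_pos hy0, Complex.ofReal_one, Complex.one_cpow]
    apply mul_left_cancel₀ g5
    rw [← k1]
    ring

/-- Generalized Stieltjes transform of type `c+` sending the solution `w₁` to the
solution `w₅` of the hypergeometric differential equation. -/
theorem stmt_13 (a b c μ : ℂ) (hc : 0 < c.re)
    (ha : 0 < (a - c - μ + 1).re) (hb : 0 < (b - c - μ + 1).re)
    (hc1 : ∀ n : ℕ, c ≠ -(n : ℂ)) (hc2 : ∀ n : ℕ, a + b - c - μ + 1 ≠ -(n : ℂ))
    (x : ℝ) (hx : 0 < x) :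
    ∫ y in Iio (0:ℝ),
        ((-y : ℝ) : ℂ) ^ (c - 1) * hypF a b c y * ((x - y : ℝ) : ℂ) ^ (μ - 1)
      = Complex.Gamma (a - c - μ + 1) * Complex.Gamma (b - c - μ + 1) * Complex.Gamma c /
          (Complex.Gamma (a + b - c - μ + 1) * Complex.Gamma (1 - μ)) *
        (x : ℂ) ^ (c + μ - 1) * hypF a b (a + b - c - μ + 1) (1 - x) := by
  rw [change_var a b c μ hx, mul_assoc]
  rcases le_or_gt x 1 with h1 | h1
  · have hab : |1 - x| < 1 := by rw [abs_lt]; constructor <;> linarith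
    rw [small_case hc ha hb hc2 hab, hypF_nonneg _ _ _ (by linarith)]
    congr 1
    have hz : ‖((1 - x : ℝ) : ℂ)‖ < 1 := by
      rw [Complex.norm_real]; exact hab
    rw [euler _ _ hc2 hz, hS_comm]
    have g1 : 1 - ((1 - x : ℝ) : ℂ) = (x:ℂ) := by push_cast; ring
    rw [g1]
    congr 2 <;> ring
  · have hx0 : (x:ℂ) ≠ 0 := by exact_mod_cast hx.ne'
    rw [large_case hc ha hb hc2 h1, hypF_neg _ _ _ (by linarith), ← mul_assoc ((x:ℂ)^(c+μ-1))]
    have g1 : (1 - (1 - x)) = x := by ring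
    have g2 : (1 - x) / (1 - x - 1) = 1 - 1 / x := by
      have : 1 - x - 1 = -x := by ring
      rw [this]; field_simp; ring
    have g3 : a + b - c - μ + 1 - b = a - c - μ + 1 := by ring
    rw [g1, g2, g3, ← Complex.cpow_add _ _ hx0, hS_comm]
    congr 2
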